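/- arXiv:0908.2918 — 3 statements merged into one kernel-verified Lean document; each statement's English description precedes it below -/
import Mathlib

section
/- Let n, p, S be positive integers, X an n×p real matrix, A an invertible p×p real matrix, and set V = X A⁻¹. Assume every column of V is nonzero, let D be the p×p diagonal matrix whose j-th diagonal entry is the ℓ²-norm of the j-th column of V, and let Ṽ = V D⁻¹ (so Ṽ has unit ℓ²-norm columns). Let η ∈ ℝᵖ be such that γ = Aη is S-sparse, and suppose δ_{2S}^{Ṽ} + θ_{S,2S}^{Ṽ} < 1. Let Y = Xη + ε* for some ε* ∈ ℝⁿ, and let λ ≥ 0 satisfy ‖Ṽᵀε*‖_∞ ≤ λ. Let γ̃̂ be any Dantzig selector solution for (Y, Ṽ, λ). Fix a vector B ∈ ℝᵖ, a real number ω ≥ 0 and a real number β₀ with |β₀ − Bᵀη| ≤ ω, and set β̂ = Bᵀ A⁻¹ D⁻¹ γ̃̂. Then |β̂ − β₀| ≤ (1/√n)·C·λ·√S + ω, where C = 4√n·‖Bᵀ A⁻¹ D⁻¹‖₂ / (1 − δ_{2S}^{Ṽ} − θ_{S,2S}^{Ṽ}). -/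
open scoped BigOperators
open Matrix

noncomputable section

/-- A vector is `S`-sparse if it has at most `S` nonzero components. -/
def SSparse {p : ℕ} (S : ℕ) (c : Fin p → ℝ) : Prop :=
  (Finset.univ.filter fun j => c j ≠ 0).card ≤ S

/-- Euclidean (ℓ²) norm of a finite vector. -/
def l2norm {k : ℕ} (c : Fin k → ℝ) : ℝ := Real.sqrt (∑ j, (c j) ^ 2)

/-- The restricted isometry constant `δ_S` of a matrix (with unit-norm columns): the smallest
`δ ≥ 0` such that `(1-δ)‖c‖₂² ≤ ‖Xc‖₂² ≤ (1+δ)‖c‖₂²` for every `S`-sparse vector `c`. -/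
def ripDelta {n p : ℕ} (X : Matrix (Fin n) (Fin p) ℝ) (S : ℕ) : ℝ :=
  sInf {δ : ℝ | 0 ≤ δ ∧ ∀ c : Fin p → ℝ, SSparse S c →
    (1 - δ) * ∑ j, (c j) ^ 2 ≤ ∑ i, (X.mulVec c i) ^ 2 ∧
      ∑ i, (X.mulVec c i) ^ 2 ≤ (1 + δ) * ∑ j, (c j) ^ 2}

/-- The restricted orthogonality constant `θ_{S,S'}` of a matrix: the smallest `θ ≥ 0` such that
`|⟨Xc, Xc'⟩| ≤ θ‖c‖₂‖c'‖₂` for all `S`-sparse `c` and `S'`-sparse `c'` with disjoint supports. -/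
def ripTheta {n p : ℕ} (X : Matrix (Fin n) (Fin p) ℝ) (S S' : ℕ) : ℝ :=
  sInf {θ : ℝ | 0 ≤ θ ∧ ∀ c c' : Fin p → ℝ, SSparse S c → SSparse S' c' →
    (∀ j, c j = 0 ∨ c' j = 0) →
    |∑ i, X.mulVec c i * X.mulVec c' i| ≤ θ * l2norm c * l2norm c'}

/-- `b` is a Dantzig selector solution for `(Y, W, λ)`: it minimizes the ℓ¹ norm over the
feasible set `{β : ‖Wᵀ(Y - Wβ)‖_∞ ≤ λ}`. -/
def IsDantzigSol {n p : ℕ} (Y : Fin n → ℝ) (W : Matrix (Fin n) (Fin p) ℝ)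
    (lam : ℝ) (b : Fin p → ℝ) : Prop :=
  (∀ j, |∑ i, W i j * (Y i - W.mulVec b i)| ≤ lam) ∧
    ∀ b' : Fin p → ℝ, (∀ j, |∑ i, W i j * (Y i - W.mulVec b' i)| ≤ lam) →
      ∑ j, |b j| ≤ ∑ j, |b' j|

/-- The ℓ² norm of the `j`-th column of a matrix. -/
def colNorm {n p : ℕ} (V : Matrix (Fin n) (Fin p) ℝ) (j : Fin p) : ℝ :=
  Real.sqrt (∑ i, (V i j) ^ 2)

/-- The vector agreeing with `h` on `P` and vanishing elsewhere. -/
def restrictTo {p : ℕ} (P : Finset (Fin p)) (h : Fin p → ℝ) : Fin p → ℝ :=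
  fun j => if j ∈ P then h j else 0

lemma sSparse_restrictTo {p S : ℕ} {P : Finset (Fin p)} (hP : P.card ≤ S) (h : Fin p → ℝ) :
    SSparse S (restrictTo P h) := by
  refine le_trans (Finset.card_le_card fun j hj => ?_) hP
  by_contra hjP
  simp [restrictTo, hjP] at hj

lemma sum_sq_restrictTo {p : ℕ} (P : Finset (Fin p)) (h : Fin p → ℝ) :
    ∑ j, (restrictTo P h j) ^ 2 = ∑ j ∈ P, (h j) ^ 2 := by
  simp [restrictTo, ite_pow]

lemma l2norm_restrictTo {p : ℕ} (P : Finset (Fin p)) (h : Fin p → ℝ) :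
    l2norm (restrictTo P h) = √(∑ j ∈ P, (h j) ^ 2) := by
  rw [l2norm, sum_sq_restrictTo]

lemma restrictTo_union {p : ℕ} {P Q : Finset (Fin p)} (hPQ : Disjoint P Q) (h : Fin p → ℝ) :
    restrictTo (P ∪ Q) h = restrictTo P h + restrictTo Q h := by
  funext j
  have hj : j ∈ P → j ∉ Q := fun hj => Finset.disjoint_left.mp hPQ hj
  by_cases h1 : j ∈ P <;> by_cases h2 : j ∈ Q <;> simp_all [restrictTo]

lemma restrictTo_add_compl {p : ℕ} (P : Finset (Fin p)) (h : Fin p → ℝ) :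
    restrictTo P h + restrictTo Pᶜ h = h := by
  funext j
  by_cases h1 : j ∈ P <;> simp [restrictTo, h1]

lemma abs_dotProduct_le_l2norm {k : ℕ} (u v : Fin k → ℝ) :
    |u ⬝ᵥ v| ≤ l2norm u * l2norm v := by
  rw [l2norm, l2norm, ← Real.sqrt_mul (Finset.sum_nonneg fun _ _ => sq_nonneg _)]
  exact Real.abs_le_sqrt (Finset.sum_mul_sq_le_sq_mul_sq _ _ _)

lemma sum_sq_mulVec_le {n p : ℕ} (X : Matrix (Fin n) (Fin p) ℝ) (c : Fin p → ℝ) :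
    ∑ i, (X.mulVec c i) ^ 2 ≤ (∑ i, ∑ j, (X i j) ^ 2) * ∑ j, (c j) ^ 2 := by
  rw [Finset.sum_mul]
  exact Finset.sum_le_sum fun i _ =>
    Finset.sum_mul_sq_le_sq_mul_sq Finset.univ (X i) c

lemma le_sInf_mul {s : Set ℝ} (hs : s.Nonempty) {x a : ℝ} (ha : 0 ≤ a)
    (h : ∀ d ∈ s, x ≤ d * a) : x ≤ sInf s * a := by
  rcases ha.eq_or_lt with rfl | ha
  · obtain ⟨d, hd⟩ := hs
    simpa using h d hd
  · rw [← div_le_iff₀ ha]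
    exact le_csInf hs fun d hd => (div_le_iff₀ ha).2 (h d hd)

lemma ripDelta_lower {n p : ℕ} (X : Matrix (Fin n) (Fin p) ℝ) {S : ℕ} {c : Fin p → ℝ}
    (hc : SSparse S c) :
    (1 - ripDelta X S) * ∑ j, (c j) ^ 2 ≤ ∑ i, (X.mulVec c i) ^ 2 := by
  have hF : 0 ≤ ∑ i, ∑ j, (X i j) ^ 2 := by positivity
  have key : (∑ j, (c j) ^ 2) - ∑ i, (X.mulVec c i) ^ 2 ≤ ripDelta X S * ∑ j, (c j) ^ 2 := by
    rw [ripDelta]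
    refine le_sInf_mul ?_ (by positivity) fun d hd => by linarith [(hd.2 c hc).1]
    refine ⟨1 + ∑ i, ∑ j, (X i j) ^ 2, by positivity, fun c' _ => ?_⟩
    have h0 : 0 ≤ ∑ i, (X.mulVec c' i) ^ 2 := by positivity
    have h1 : 0 ≤ ∑ j, (c' j) ^ 2 := by positivity
    have h2 := sum_sq_mulVec_le X c'
    constructor <;> nlinarith [mul_nonneg hF h1]
  linarith

lemma ripTheta_nonneg {n p : ℕ} (X : Matrix (Fin n) (Fin p) ℝ) (S S' : ℕ) :
    0 ≤ ripTheta X S S' :=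
  Real.sInf_nonneg fun _ hd => hd.1

lemma abs_dotProduct_mulVec_le_ripTheta {n p : ℕ} (X : Matrix (Fin n) (Fin p) ℝ) {S S' : ℕ}
    {c c' : Fin p → ℝ} (hc : SSparse S c) (hc' : SSparse S' c')
    (hdisj : ∀ j, c j = 0 ∨ c' j = 0) :
    |X.mulVec c ⬝ᵥ X.mulVec c'| ≤ ripTheta X S S' * (l2norm c * l2norm c') := by
  have hmul (u : Fin p → ℝ) : l2norm (X.mulVec u) ≤ √(∑ i, ∑ j, (X i j) ^ 2) * l2norm u := by
    rw [l2norm, l2norm, ← Real.sqrt_mul (by positivity)]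
    exact Real.sqrt_le_sqrt (sum_sq_mulVec_le X u)
  rw [ripTheta]
  refine le_sInf_mul ?_ (mul_nonneg (Real.sqrt_nonneg _) (Real.sqrt_nonneg _))
    fun d hd => (hd.2 c c' hc hc' hdisj).trans_eq (mul_assoc _ _ _)
  refine ⟨√(∑ i, ∑ j, (X i j) ^ 2) * √(∑ i, ∑ j, (X i j) ^ 2), by positivity,
    fun u v _ _ _ => ?_⟩
  refine (abs_dotProduct_le_l2norm _ _).trans ?_
  calc l2norm (X.mulVec u) * l2norm (X.mulVec v)
      ≤ (√(∑ i, ∑ j, (X i j) ^ 2) * l2norm u) * (√(∑ i, ∑ j, (X i j) ^ 2) * l2norm v) :=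
        mul_le_mul (hmul u) (hmul v) (Real.sqrt_nonneg _)
          (mul_nonneg (Real.sqrt_nonneg _) (Real.sqrt_nonneg _))
    _ = _ := by ring

lemma exists_largest_subset {α : Type*} [DecidableEq α] (f : α → ℝ) (U : Finset α) (k : ℕ)
    (hk : k ≤ U.card) :
    ∃ P ⊆ U, P.card = k ∧ ∀ i ∈ P, ∀ j ∈ U \ P, f j ≤ f i := by
  induction k with
  | zero => exact ⟨∅, by simp, by simp, by simp⟩
  | succ k ih =>
    obtain ⟨P, hPU, hcard, hP⟩ := ih (by omega)
    have hne : (U \ P).Nonempty := by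
      rw [← Finset.card_pos, Finset.card_sdiff_of_subset hPU]
      omega
    obtain ⟨m, hm, hmax⟩ := Finset.exists_max_image (U \ P) f hne
    have hm' := Finset.mem_sdiff.1 hm
    refine ⟨insert m P, Finset.insert_subset hm'.1 hPU, ?_, fun i hi j hj => ?_⟩
    · rw [Finset.card_insert_of_notMem hm'.2, hcard]
    · have hj' : j ∈ U \ P := by
        simp only [Finset.mem_sdiff, Finset.mem_insert, not_or] at hj ⊢
        exact ⟨hj.1, hj.2.2⟩
      rcases Finset.mem_insert.1 hi with rfl | hi
      · exact hmax j hj'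
      · exact hP i hi j hj'

/-- If `f` on `U` is split into its `S` largest values and the rest, the rest is bounded by the
average of the largest values. -/
lemma exists_largest_block {α : Type*} [DecidableEq α] {f : α → ℝ} (hf : ∀ i, 0 ≤ f i)
    {U : Finset α} {S : ℕ} (hS : 0 < S) (hU : S ≤ U.card) :
    ∃ P ⊆ U, P.card = S ∧ ∃ M, 0 ≤ M ∧ (∀ j ∈ U \ P, f j ≤ M) ∧ √S * M ≤ (∑ i ∈ P, f i) / √S := by
  obtain ⟨P, hPU, hcard, hP⟩ := exists_largest_subset f U S hU
  obtain ⟨m, hm, hmin⟩ := Finset.exists_min_image P f (Finset.card_pos.1 (by omega))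
  have hSpos : (0 : ℝ) < S := by exact_mod_cast hS
  refine ⟨P, hPU, hcard, f m, hf m, fun j hj => hP m hm j hj, ?_⟩
  rw [le_div_iff₀ (Real.sqrt_pos.2 hSpos), mul_right_comm, Real.mul_self_sqrt hSpos.le,
    ← nsmul_eq_mul, ← hcard]
  exact Finset.card_nsmul_le_sum _ _ _ hmin

/-- A subadditive set function which is controlled by the `ℓ²` norm of `h` on blocks of size at
most `S` is controlled by the sup and `ℓ¹` norms of `h`. -/
lemma subadditive_le_of_block_le {α : Type*} [DecidableEq α] (h : α → ℝ) {S : ℕ} (hS : 0 < S)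
    (N : Finset α → ℝ) {K : ℝ} (hK : 0 ≤ K)
    (hadd : ∀ P Q, Disjoint P Q → N (P ∪ Q) ≤ N P + N Q) (U : Finset α)
    (hblock : ∀ P ⊆ U, P.card ≤ S → N P ≤ K * √(∑ j ∈ P, (h j) ^ 2))
    {M : ℝ} (hM : 0 ≤ M) (hUM : ∀ j ∈ U, |h j| ≤ M) :
    N U ≤ K * (√S * M + (∑ j ∈ U, |h j|) / √S) := by
  have hSpos : (0 : ℝ) < S := by exact_mod_cast hS
  have hsmall {P : Finset α} {M : ℝ} (hM : 0 ≤ M) (hcard : P.card ≤ S)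
      (hPM : ∀ j ∈ P, |h j| ≤ M) : √(∑ j ∈ P, (h j) ^ 2) ≤ √S * M := by
    rw [← Real.sqrt_sq hM, ← Real.sqrt_mul hSpos.le]
    refine Real.sqrt_le_sqrt ?_
    calc ∑ j ∈ P, (h j) ^ 2 ≤ P.card • M ^ 2 :=
          Finset.sum_le_card_nsmul _ _ _ fun j hj => by
            rw [← sq_abs]; exact pow_le_pow_left₀ (abs_nonneg _) (hPM j hj) 2
      _ ≤ S * M ^ 2 := by
          rw [nsmul_eq_mul]
          exact mul_le_mul_of_nonneg_right (by exact_mod_cast hcard) (sq_nonneg _)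
  induction hn : U.card using Nat.strong_induction_on generalizing U M with
  | _ n ih =>
    rcases le_or_gt U.card S with hc | hc
    · refine (hblock U subset_rfl hc).trans (mul_le_mul_of_nonneg_left ?_ hK)
      have : 0 ≤ (∑ j ∈ U, |h j|) / √S := by positivity
      linarith [hsmall hM hc hUM]
    · obtain ⟨P, hPU, hcard, M', hM', hrest, hav⟩ :=
        exists_largest_block (f := fun j => |h j|) (fun _ => abs_nonneg _) hS hc.le
      have h1 := hadd P (U \ P) Finset.disjoint_sdiff
      rw [Finset.union_sdiff_of_subset hPU] at h1
      have h2 := (hblock P hPU hcard.le).trans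
        (mul_le_mul_of_nonneg_left (hsmall hM hcard.le fun j hj => hUM j (hPU hj)) hK)
      have h3 := ih (U \ P).card (by rw [Finset.card_sdiff_of_subset hPU]; omega) (U \ P)
        (fun Q hQ => hblock Q (hQ.trans Finset.sdiff_subset)) hM' hrest rfl
      have h4 : (∑ j ∈ U, |h j|) / √S
          = (∑ j ∈ U \ P, |h j|) / √S + (∑ j ∈ P, |h j|) / √S := by
        rw [← add_div, Finset.sum_sdiff hPU]
      have h5 := mul_le_mul_of_nonneg_left hav hK
      rw [h4]
      linarith

lemma sum_abs_le_sqrt_card_mul {α : Type*} (h : α → ℝ) {P : Finset α} {k : ℝ}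
    (hk : (P.card : ℝ) ≤ k) : ∑ j ∈ P, |h j| ≤ √k * √(∑ j ∈ P, (h j) ^ 2) := by
  rw [← Real.sqrt_mul (le_trans (Nat.cast_nonneg _) hk)]
  refine Real.le_sqrt_of_sq_le ?_
  calc (∑ j ∈ P, |h j|) ^ 2 ≤ P.card * ∑ j ∈ P, |h j| ^ 2 := sq_sum_le_card_mul_sum_sq
    _ ≤ k * ∑ j ∈ P, (h j) ^ 2 := by
      simp only [sq_abs]
      exact mul_le_mul_of_nonneg_right hk (by positivity)

/-- For `T₀` of size at most `S`, there is a superset of size at most `2S` outside of which every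
subadditive set function controlled on blocks is controlled by the `ℓ¹` norm of `h` off `T₀`. -/
lemma exists_head_set {p S : ℕ} (hS : 0 < S) (h : Fin p → ℝ) (T₀ : Finset (Fin p))
    (hT₀ : T₀.card ≤ S) :
    ∃ T : Finset (Fin p), T₀ ⊆ T ∧ T.card ≤ 2 * S ∧
      ∀ (N : Finset (Fin p) → ℝ) (K : ℝ), 0 ≤ K →
        (∀ P Q, Disjoint P Q → N (P ∪ Q) ≤ N P + N Q) →
        (∀ P ⊆ Tᶜ, P.card ≤ S → N P ≤ K * √(∑ j ∈ P, (h j) ^ 2)) →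
        N Tᶜ ≤ K * ((∑ j ∈ T₀ᶜ, |h j|) / √S) := by
  rcases le_or_gt S T₀ᶜ.card with hc | hc
  · obtain ⟨P, hPU, hcard, M, hM, hrest, hav⟩ :=
      exists_largest_block (f := fun j => |h j|) (fun _ => abs_nonneg _) hS hc
    have hcompl : (T₀ ∪ P)ᶜ = T₀ᶜ \ P := by
      ext j; simp
    refine ⟨T₀ ∪ P, Finset.subset_union_left, (Finset.card_union_le _ _).trans (by omega),
      fun N K hK hadd hblock => ?_⟩
    have h1 := subadditive_le_of_block_le h hS N hK hadd (T₀ ∪ P)ᶜ hblock hM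
      (by rw [hcompl]; exact hrest)
    refine h1.trans (mul_le_mul_of_nonneg_left ?_ hK)
    rw [hcompl, ← Finset.sum_sdiff hPU, add_div]
    linarith
  · refine ⟨Finset.univ, Finset.subset_univ _, ?_, fun N K hK hadd hblock => ?_⟩
    · have := Finset.card_add_card_compl T₀
      rw [Finset.card_univ]
      omega
    · refine (hblock _ subset_rfl (by simp)).trans ?_
      simp only [Finset.compl_univ, Finset.sum_empty, Real.sqrt_zero, mul_zero]
      positivity

/-- `ℓ²` bound for a vector satisfying the cone condition and with small correlations. -/
lemma l2norm_le_of_cone {n p S : ℕ} (hS : 0 < S) (W : Matrix (Fin n) (Fin p) ℝ)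
    (hrip : ripDelta W (2 * S) + ripTheta W S (2 * S) < 1) (h : Fin p → ℝ)
    (T₀ : Finset (Fin p)) (hT₀ : T₀.card ≤ S)
    (hcone : ∑ j ∈ T₀ᶜ, |h j| ≤ ∑ j ∈ T₀, |h j|) {μ : ℝ} (hμ : 0 ≤ μ)
    (hcorr : ∀ j, |(Wᵀ.mulVec (W.mulVec h)) j| ≤ μ) :
    (1 - ripDelta W (2 * S) - ripTheta W S (2 * S)) * l2norm h ≤ 2 * √S * μ := by
  obtain ⟨T, hT₀T, hT, hhead⟩ := exists_head_set hS h T₀ hT₀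
  have hSpos : (0 : ℝ) < S := by exact_mod_cast hS
  have hsS : 0 < √(S : ℝ) := Real.sqrt_pos.2 hSpos
  set δ := ripDelta W (2 * S)
  set θ := ripTheta W S (2 * S)
  have hθ : 0 ≤ θ := ripTheta_nonneg _ _ _
  set a := √(∑ j ∈ T, (h j) ^ 2) with ha
  have ha0 : 0 ≤ a := Real.sqrt_nonneg _
  have ha2 : a ^ 2 = ∑ j ∈ T, (h j) ^ 2 := Real.sq_sqrt (by positivity)
  have htail : (∑ j ∈ T₀ᶜ, |h j|) / √S ≤ a := by
    rw [div_le_iff₀ hsS, mul_comm]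
    refine hcone.trans ((sum_abs_le_sqrt_card_mul h (by exact_mod_cast hT₀)).trans
      (mul_le_mul_of_nonneg_left (Real.sqrt_le_sqrt ?_) hsS.le))
    exact Finset.sum_le_sum_of_subset_of_nonneg hT₀T fun _ _ _ => sq_nonneg _
  have hcross : |W.mulVec (restrictTo Tᶜ h) ⬝ᵥ W.mulVec (restrictTo T h)| ≤ θ * a * a := by
    refine (hhead (fun P => |W.mulVec (restrictTo P h) ⬝ᵥ W.mulVec (restrictTo T h)|) (θ * a)
      (by positivity) (fun P Q hPQ => ?_) (fun P hP hcard => ?_)).trans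
      (mul_le_mul_of_nonneg_left htail (by positivity))
    · simp only [restrictTo_union hPQ, Matrix.mulVec_add, add_dotProduct]
      exact abs_add_le _ _
    · refine (abs_dotProduct_mulVec_le_ripTheta W (sSparse_restrictTo hcard h)
        (sSparse_restrictTo hT h) fun j => ?_).trans_eq ?_
      · by_cases hj : j ∈ P
        · exact Or.inr (if_neg (Finset.mem_compl.1 (hP hj)))
        · exact Or.inl (if_neg hj)
      · rw [l2norm_restrictTo, l2norm_restrictTo]
        ring
  have htail2 : √(∑ j ∈ Tᶜ, (h j) ^ 2) ≤ a := by
    refine (hhead (fun P => √(∑ j ∈ P, (h j) ^ 2)) 1 zero_le_one (fun P Q hPQ => ?_)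
      (fun P _ _ => (one_mul _).ge)).trans ((one_mul _).trans_le htail)
    simp only [Finset.sum_union hPQ]
    refine Real.sqrt_le_iff.2 ⟨by positivity, ?_⟩
    rw [add_sq, Real.sq_sqrt (by positivity), Real.sq_sqrt (by positivity)]
    have : 0 ≤ 2 * √(∑ j ∈ P, (h j) ^ 2) * √(∑ j ∈ Q, (h j) ^ 2) := by positivity
    linarith
  have hcorrT : |W.mulVec h ⬝ᵥ W.mulVec (restrictTo T h)| ≤ μ * (√(2 * S) * a) := by
    rw [Matrix.dotProduct_mulVec, ← Matrix.mulVec_transpose]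
    have h1 : Wᵀ.mulVec (W.mulVec h) ⬝ᵥ restrictTo T h
        = ∑ j ∈ T, Wᵀ.mulVec (W.mulVec h) j * h j := by
      simp [dotProduct, restrictTo]
    rw [h1]
    calc |∑ j ∈ T, Wᵀ.mulVec (W.mulVec h) j * h j|
        ≤ ∑ j ∈ T, |Wᵀ.mulVec (W.mulVec h) j * h j| := Finset.abs_sum_le_sum_abs _ _
      _ ≤ ∑ j ∈ T, μ * |h j| := Finset.sum_le_sum fun j _ => by
          rw [abs_mul]; exact mul_le_mul_of_nonneg_right (hcorr j) (abs_nonneg _)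
      _ = μ * ∑ j ∈ T, |h j| := (Finset.mul_sum _ _ _).symm
      _ ≤ _ := mul_le_mul_of_nonneg_left
          (sum_abs_le_sqrt_card_mul h (by exact_mod_cast hT)) hμ
  have hlow : (1 - δ) * a ^ 2 ≤ W.mulVec (restrictTo T h) ⬝ᵥ W.mulVec (restrictTo T h) := by
    have := ripDelta_lower W (sSparse_restrictTo hT h)
    rw [sum_sq_restrictTo, ← ha2] at this
    simpa [dotProduct, sq] using this
  have hsplit : W.mulVec h ⬝ᵥ W.mulVec (restrictTo T h)
      = W.mulVec (restrictTo T h) ⬝ᵥ W.mulVec (restrictTo T h)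
        + W.mulVec (restrictTo Tᶜ h) ⬝ᵥ W.mulVec (restrictTo T h) := by
    rw [← add_dotProduct, ← Matrix.mulVec_add, restrictTo_add_compl]
  have hmain : (1 - δ - θ) * a ≤ μ * √(2 * S) := by
    rcases ha0.eq_or_lt with h0 | h0
    · rw [← h0, mul_zero]; positivity
    · refine le_of_mul_le_mul_right ?_ h0
      have h1 := (abs_le.1 hcross).1
      have h2 := (abs_le.1 hcorrT).2
      nlinarith
  have hl2 : l2norm h ≤ √2 * a := by
    rw [l2norm]
    refine Real.sqrt_le_iff.2 ⟨by positivity, ?_⟩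
    rw [mul_pow, Real.sq_sqrt zero_le_two, ← Finset.sum_add_sum_compl T, ← ha2]
    have := (Real.sqrt_le_left ha0).1 htail2
    linarith
  calc (1 - δ - θ) * l2norm h ≤ (1 - δ - θ) * (√2 * a) :=
        mul_le_mul_of_nonneg_left hl2 (by linarith)
    _ = √2 * ((1 - δ - θ) * a) := by ring
    _ ≤ √2 * (μ * √(2 * S)) := mul_le_mul_of_nonneg_left hmain (by positivity)
    _ = (√2 * √2) * √S * μ := by rw [Real.sqrt_mul zero_le_two]; ring
    _ = 2 * √S * μ := by rw [Real.mul_self_sqrt zero_le_two]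

/-- If `b` has no larger `ℓ¹` norm than `g`, the error `b - g` has at most as much `ℓ¹` mass off
the support of `g` as on it. -/
lemma sum_abs_sub_compl_le {α : Type*} [Fintype α] [DecidableEq α] {b g : α → ℝ}
    (hbg : ∑ j, |b j| ≤ ∑ j, |g j|) {T : Finset α} (hT : ∀ j ∉ T, g j = 0) :
    ∑ j ∈ Tᶜ, |(b - g) j| ≤ ∑ j ∈ T, |(b - g) j| := by
  rw [← Finset.sum_add_sum_compl T, ← Finset.sum_add_sum_compl T (fun j => |g j|)] at hbg
  have h1 : ∑ j ∈ Tᶜ, |g j| = 0 :=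
    Finset.sum_eq_zero fun j hj => by rw [hT j (Finset.mem_compl.1 hj), abs_zero]
  have h2 : ∑ j ∈ Tᶜ, |(b - g) j| = ∑ j ∈ Tᶜ, |b j| :=
    Finset.sum_congr rfl fun j hj => by
      rw [Pi.sub_apply, hT j (Finset.mem_compl.1 hj), sub_zero]
  have h3 : ∑ j ∈ T, |g j| ≤ ∑ j ∈ T, |b j| + ∑ j ∈ T, |(b - g) j| := by
    rw [← Finset.sum_add_distrib]
    refine Finset.sum_le_sum fun j _ => ?_
    rw [Pi.sub_apply, abs_sub_comm]
    linarith [abs_sub_abs_le_abs_sub (g j) (b j)]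
  linarith

/-- The Candès–Tao `ℓ²` error bound for the Dantzig selector. -/
lemma IsDantzigSol.l2norm_sub_le {n p S : ℕ} (hS : 0 < S) {W : Matrix (Fin n) (Fin p) ℝ}
    (hrip : ripDelta W (2 * S) + ripTheta W S (2 * S) < 1) {g : Fin p → ℝ} (hg : SSparse S g)
    {ε : Fin n → ℝ} {lam : ℝ} (hlam : 0 ≤ lam) (hε : ∀ j, |∑ i, W i j * ε i| ≤ lam)
    {b : Fin p → ℝ} (hb : IsDantzigSol (W.mulVec g + ε) W lam b) :
    (1 - ripDelta W (2 * S) - ripTheta W S (2 * S)) * l2norm (b - g) ≤ 4 * lam * √S := by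
  have hgfeas : ∑ j, |b j| ≤ ∑ j, |g j| := hb.2 g fun j => by simpa using hε j
  have hcone := sum_abs_sub_compl_le hgfeas (T := Finset.univ.filter fun j => g j ≠ 0)
    fun j hj => by simpa using hj
  have hcorr (j : Fin p) : |(Wᵀ.mulVec (W.mulVec (b - g))) j| ≤ 2 * lam := by
    have h1 : (Wᵀ.mulVec (W.mulVec (b - g))) j
        = (∑ i, W i j * ε i) - ∑ i, W i j * ((W.mulVec g + ε) i - W.mulVec b i) := by
      rw [← Finset.sum_sub_distrib, Matrix.mulVec_sub, Matrix.mulVec, dotProduct]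
      refine Finset.sum_congr rfl fun i _ => ?_
      simp only [Matrix.transpose_apply, Pi.sub_apply, Pi.add_apply]
      ring
    rw [h1]
    refine (abs_sub _ _).trans ?_
    linarith [hε j, hb.1 j]
  have := l2norm_le_of_cone hS W hrip (b - g) _ hg hcone (by positivity) hcorr
  linarith

/-- **Theorem 1 of the paper (Dantzig selector version, at a fixed evaluation point).**
If `γ = Aη` is `S`-sparse, `δ_{2S}^{Ṽ} + θ_{S,2S}^{Ṽ} < 1`, `‖Ṽᵀε*‖_∞ ≤ λ`, and `γ̂` is a
Dantzig selector solution for `(Y, Ṽ, λ)` with `Y = Xη + ε*`, then the FLiRTI estimate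
`β̂ = Bᵀ A⁻¹ D⁻¹ γ̂` satisfies `|β̂ - β₀| ≤ (1/√n)·C·λ·√S + ω` whenever `|β₀ - Bᵀη| ≤ ω`,
where `C = 4√n‖Bᵀ A⁻¹ D⁻¹‖₂ / (1 - δ_{2S}^{Ṽ} - θ_{S,2S}^{Ṽ})`. -/
theorem flirti_thm1 {n p S : ℕ} (hn : 0 < n) (hp : 0 < p) (hS : 0 < S)
    (X : Matrix (Fin n) (Fin p) ℝ) (A : Matrix (Fin p) (Fin p) ℝ) (hA : IsUnit A.det)
    (V : Matrix (Fin n) (Fin p) ℝ) (hV : V = X * A⁻¹)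
    (hcol : ∀ j, colNorm V j ≠ 0)
    (D : Matrix (Fin p) (Fin p) ℝ) (hD : D = Matrix.diagonal (colNorm V))
    (Vt : Matrix (Fin n) (Fin p) ℝ) (hVt : Vt = V * D⁻¹)
    (η : Fin p → ℝ) (hsparse : SSparse S (A.mulVec η))
    (hrip : ripDelta Vt (2 * S) + ripTheta Vt S (2 * S) < 1)
    (ε : Fin n → ℝ) (Y : Fin n → ℝ) (hY : Y = X.mulVec η + ε)
    (lam : ℝ) (hlam : 0 ≤ lam) (hfeas : ∀ j, |∑ i, Vt i j * ε i| ≤ lam)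
    (γhat : Fin p → ℝ) (hDS : IsDantzigSol Y Vt lam γhat)
    (B : Fin p → ℝ) (ω : ℝ) (hω : 0 ≤ ω) (β₀ : ℝ) (hβ₀ : |β₀ - B ⬝ᵥ η| ≤ ω)
    (βhat : ℝ) (hβhat : βhat = B ⬝ᵥ (A⁻¹ * D⁻¹).mulVec γhat)
    (C : ℝ) (hC : C = 4 * Real.sqrt n * l2norm (Matrix.vecMul B (A⁻¹ * D⁻¹)) /
      (1 - ripDelta Vt (2 * S) - ripTheta Vt S (2 * S))) :
    |βhat - β₀| ≤ (1 / Real.sqrt n) * C * lam * Real.sqrt S + ω := by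
  have hdet : IsUnit D.det := by
    rw [hD, Matrix.det_diagonal, isUnit_iff_ne_zero]
    exact Finset.prod_ne_zero_iff.2 fun j _ => hcol j
  have hinv : (A⁻¹ * D⁻¹).mulVec (D.mulVec (A.mulVec η)) = η := by
    rw [Matrix.mulVec_mulVec, Matrix.mulVec_mulVec, Matrix.mul_assoc, Matrix.mul_assoc,
      Matrix.nonsing_inv_mul_cancel_left _ _ hdet, Matrix.nonsing_inv_mul _ hA, Matrix.one_mulVec]
  have hVtη : Vt.mulVec (D.mulVec (A.mulVec η)) = X.mulVec η := by
    rw [hVt, hV, Matrix.mul_assoc, ← Matrix.mulVec_mulVec, hinv]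
  have hgsparse : SSparse S (D.mulVec (A.mulVec η)) := by
    refine le_trans (Finset.card_le_card fun j hj => ?_) hsparse
    simp only [hD, Matrix.mulVec_diagonal, Finset.mem_filter, Finset.mem_univ, true_and] at hj ⊢
    exact right_ne_zero_of_mul hj
  rw [hY, ← hVtη] at hDS
  have herr := hDS.l2norm_sub_le hS hrip hgsparse hlam hfeas
  set g := D.mulVec (A.mulVec η)
  set v := Matrix.vecMul B (A⁻¹ * D⁻¹)
  set κ := 1 - ripDelta Vt (2 * S) - ripTheta Vt S (2 * S) with hκ
  have hκpos : 0 < κ := by linarith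
  have hsn : √(n : ℝ) ≠ 0 := (Real.sqrt_pos.2 (by exact_mod_cast hn)).ne'
  have hest : βhat - B ⬝ᵥ η = v ⬝ᵥ (γhat - g) := by
    rw [hβhat, dotProduct_sub, ← Matrix.dotProduct_mulVec, ← Matrix.dotProduct_mulVec, hinv]
  have hbound : |βhat - B ⬝ᵥ η| ≤ 1 / √n * C * lam * √S := by
    have hC' : 1 / √n * C * lam * √S = l2norm v * ((4 * lam * √S) / κ) := by
      rw [hC]
      field_simp
    rw [hest, hC']
    refine (abs_dotProduct_le_l2norm _ _).trans
      (mul_le_mul_of_nonneg_left ?_ (Real.sqrt_nonneg _))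
    rwa [le_div_iff₀ hκpos, mul_comm]
  have htri := abs_sub_le βhat (B ⬝ᵥ η) β₀
  rw [abs_sub_comm (B ⬝ᵥ η) β₀] at htri
  linarith
end
end

section
/- Let m > 0 and b ≥ 0, and let S > 0, σ > 0, φ ≥ 0, H > 0, K ≥ 0 and 0 < c₁ ≤ c₂ be real constants. Let (pₙ)_{n≥2} be a sequence of real numbers with pₙ ≥ 2 and c₁·n^{1/(2(m+b))} ≤ pₙ ≤ c₂·n^{1/(2(m+b))} for all n ≥ 2, and let (Cₙ) and (ωₙ) be sequences of nonnegative reals with Cₙ ≤ K·pₙ^b and ωₙ ≤ H·pₙ^{−m} for all n. Then there exists a constant K' such that for every n ≥ 2, (1/√n)·Cₙ·σ·√(2S(1+φ) log pₙ) + ωₙ ≤ K'·√(log n)·n^{−m/(2(m+b))}. -/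
/-- If `p ≤ c x ^ a` with `x ≥ 2`, then `log p` is at most a constant multiple of `log x`. -/
lemma log_le_mul_log_of_le_mul_rpow {p c x a : ℝ} (hp : 0 < p) (hc : 0 < c) (hx : 2 ≤ x)
    (h : p ≤ c * x ^ a) :
    Real.log p ≤ (|Real.log c| / Real.log 2 + a) * Real.log x := by
  have hx0 : 0 < x := by linarith
  have hlog2 : 0 < Real.log 2 := Real.log_pos one_lt_two
  have hlogx : Real.log 2 ≤ Real.log x := Real.log_le_log two_pos hx
  calc Real.log p ≤ Real.log (c * x ^ a) := Real.log_le_log hp h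
    _ = Real.log c + a * Real.log x := by
      rw [Real.log_mul hc.ne' (Real.rpow_pos_of_pos hx0 a).ne', Real.log_rpow hx0]
    _ ≤ |Real.log c| / Real.log 2 * Real.log 2 + a * Real.log x := by
      rw [div_mul_cancel₀ _ hlog2.ne']
      gcongr
      exact le_abs_self _
    _ ≤ |Real.log c| / Real.log 2 * Real.log x + a * Real.log x := by gcongr
    _ = _ := by ring

/-- A bound `p ≤ c x ^ a` raised to a nonnegative power. -/
lemma rpow_le_of_le_mul_rpow {p c x a b : ℝ} (hp : 0 ≤ p) (hc : 0 ≤ c) (hx : 0 ≤ x)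
    (hb : 0 ≤ b) (h : p ≤ c * x ^ a) : p ^ b ≤ c ^ b * x ^ (a * b) := by
  rw [Real.rpow_mul hx, ← Real.mul_rpow hc (Real.rpow_nonneg hx a)]
  exact Real.rpow_le_rpow hp h hb

/-- A bound `c x ^ a ≤ p` raised to a nonpositive power. -/
lemma rpow_neg_le_of_mul_rpow_le {p c x a m : ℝ} (hc : 0 < c) (hx : 0 < x)
    (hm : 0 ≤ m) (h : c * x ^ a ≤ p) : p ^ (-m) ≤ c ^ (-m) * x ^ (-(a * m)) := by
  rw [← mul_neg, Real.rpow_mul hx.le, ← Real.mul_rpow hc.le (Real.rpow_nonneg hx.le a)]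
  exact Real.rpow_le_rpow_of_nonpos (mul_pos hc (Real.rpow_pos_of_pos hx a)) h (neg_nonpos.2 hm)

/-- **The analytical content of Theorem 6 of the paper.** If `pₙ ≍ n^{1/(2(m+b))}`,
`Cₙ ≤ K pₙ^b` and `ωₙ ≤ H pₙ^{-m}` with `m > 0`, `b ≥ 0`, then
`(1/√n) Cₙ σ √(2S(1+φ) log pₙ) + ωₙ ≤ K' √(log n) n^{-m/(2(m+b))}`
for some constant `K'` and all `n ≥ 2`. -/
theorem flirti_thm6_rate (m b S σ φ H K c₁ c₂ : ℝ)
    (hm : 0 < m) (hb : 0 ≤ b) (hS : 0 < S) (hσ : 0 < σ)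
    (hφ : 0 ≤ φ) (hH : 0 < H) (hK : 0 ≤ K)
    (hc₁ : 0 < c₁) (hc₁₂ : c₁ ≤ c₂)
    (p C ω : ℕ → ℝ)
    (hp2 : ∀ n : ℕ, 2 ≤ n → (2 : ℝ) ≤ p n)
    (hpl : ∀ n : ℕ, 2 ≤ n → c₁ * (n : ℝ) ^ (1 / (2 * (m + b))) ≤ p n)
    (hpu : ∀ n : ℕ, 2 ≤ n → p n ≤ c₂ * (n : ℝ) ^ (1 / (2 * (m + b))))
    (hC0 : ∀ n : ℕ, 2 ≤ n → 0 ≤ C n) (hω0 : ∀ n : ℕ, 2 ≤ n → 0 ≤ ω n)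
    (hCb : ∀ n : ℕ, 2 ≤ n → C n ≤ K * p n ^ b)
    (hωb : ∀ n : ℕ, 2 ≤ n → ω n ≤ H * p n ^ (-m)) :
    ∃ K' : ℝ, ∀ n : ℕ, 2 ≤ n →
      (1 / Real.sqrt n) * C n * σ * Real.sqrt (2 * S * (1 + φ) * Real.log (p n)) + ω n ≤
      K' * Real.sqrt (Real.log n) * (n : ℝ) ^ (-(m / (2 * (m + b)))) := by
  have hmb : 0 < m + b := by linarith
  have hc₂ : 0 < c₂ := hc₁.trans_le hc₁₂
  have hlog2 : 0 < Real.log 2 := Real.log_pos one_lt_two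
  set a : ℝ := 1 / (2 * (m + b)) with ha
  have hexp : m / (2 * (m + b)) = a * m := by rw [ha]; ring
  have hbal : a * b = 1 / 2 + -(a * m) := by rw [ha]; field_simp; ring
  set L : ℝ := |Real.log c₂| / Real.log 2 + a
  refine ⟨K * c₂ ^ b * σ * Real.sqrt (2 * S * (1 + φ) * L)
    + H * c₁ ^ (-m) / Real.sqrt (Real.log 2), fun n hn => ?_⟩
  have hn2 : (2 : ℝ) ≤ n := by exact_mod_cast hn
  have hn0 : (0 : ℝ) < n := by linarith
  have hp0 : 0 < p n := two_pos.trans_le (hp2 n hn)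
  have hlogn : Real.log 2 ≤ Real.log n := Real.log_le_log two_pos hn2
  have hlog := log_le_mul_log_of_le_mul_rpow hp0 hc₂ hn2 (hpu n hn)
  have hsqrt : Real.sqrt (2 * S * (1 + φ) * Real.log (p n)) ≤
      Real.sqrt (2 * S * (1 + φ) * L) * Real.sqrt (Real.log n) := by
    rw [← Real.sqrt_mul' _ (hlog2.le.trans hlogn), mul_assoc (2 * S * (1 + φ))]
    gcongr
  have hCn : (1 / Real.sqrt n) * C n ≤ K * c₂ ^ b * (n : ℝ) ^ (-(a * m)) := by
    rw [one_div, inv_mul_le_iff₀ (Real.sqrt_pos.2 hn0)]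
    calc C n ≤ K * p n ^ b := hCb n hn
      _ ≤ K * (c₂ ^ b * (n : ℝ) ^ (a * b)) := by
        gcongr
        exact rpow_le_of_le_mul_rpow hp0.le hc₂.le hn0.le hb (hpu n hn)
      _ = Real.sqrt n * (K * c₂ ^ b * (n : ℝ) ^ (-(a * m))) := by
        rw [hbal, Real.rpow_add hn0, Real.sqrt_eq_rpow]
        ring
  have hωn : ω n ≤ H * c₁ ^ (-m) / Real.sqrt (Real.log 2) * Real.sqrt (Real.log n)
      * (n : ℝ) ^ (-(a * m)) := by
    have hr : 1 ≤ Real.sqrt (Real.log n) / Real.sqrt (Real.log 2) :=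
      (one_le_div (Real.sqrt_pos.2 hlog2)).2 (Real.sqrt_le_sqrt hlogn)
    calc ω n ≤ H * p n ^ (-m) := hωb n hn
      _ ≤ H * (c₁ ^ (-m) * (n : ℝ) ^ (-(a * m))) := by
        gcongr
        exact rpow_neg_le_of_mul_rpow_le hc₁ hn0 hm.le (hpl n hn)
      _ ≤ H * (c₁ ^ (-m) * (n : ℝ) ^ (-(a * m)))
          * (Real.sqrt (Real.log n) / Real.sqrt (Real.log 2)) :=
        le_mul_of_one_le_right (by positivity) hr
      _ = _ := by ring
  rw [hexp]
  calc (1 / Real.sqrt n) * C n * σ * Real.sqrt (2 * S * (1 + φ) * Real.log (p n)) + ω n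
      ≤ K * c₂ ^ b * (n : ℝ) ^ (-(a * m)) * σ
          * (Real.sqrt (2 * S * (1 + φ) * L) * Real.sqrt (Real.log n))
        + H * c₁ ^ (-m) / Real.sqrt (Real.log 2) * Real.sqrt (Real.log n)
          * (n : ℝ) ^ (-(a * m)) := by gcongr
    _ = _ := by ring
end

section
/- Let p ≥ 3 and n ≥ 1 be integers, W > 0, t ∈ (0,1), and let k = ⌊pt⌋ and assume k ≥ 1. Let M be the p×p matrix with M_{i1} = 1 for all i, M₁₂ = 0 and M_{i2} = (i−1)/p for 2 ≤ i ≤ p, and, for 3 ≤ j ≤ p, M_{ij} = (i−j+1)/p² if i ≥ j and 0 otherwise. Let X be an n×p real matrix with X_{il} ≥ W for all i, l. Define α = √( Σ_{j=1}^{k} M_{kj}² / ( (1/n) Σ_{i=1}^{n} ( (1/p) Σ_{l=1}^{p} X_{il} M_{lj} )² ) ). Then α ≤ (1/W)·( 1 + 2√p · t^{3/2} / (1−t)² ). -/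
theorem sum_Icc_truncated (j m : ℕ) (hj : 1 ≤ j) (hm : j ≤ m + 1) :
    ∑ l ∈ Finset.Icc 1 m, (if j ≤ l then (l : ℝ) - j + 1 else 0) =
      ((m : ℝ) - j + 1) * ((m : ℝ) - j + 2) / 2 := by
  obtain ⟨a, rfl⟩ : ∃ a, j = a + 1 := ⟨j - 1, by omega⟩
  have ham : a ≤ m := by omega
  induction m, ham using Nat.le_induction with
  | base =>
    rw [Finset.sum_eq_zero]
    · push_cast
      ring
    · intro l hl
      rw [if_neg]
      have := (Finset.mem_Icc.mp hl).2
      omega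
  | succ m ham ih =>
    rw [Finset.sum_Icc_succ_top (by omega), ih (by omega), if_pos (by omega)]
    push_cast
    ring

/-- If all predictors are at least `W`, the mean of the squared weighted averages is at least
the square of `W` times the average weight. -/
theorem sq_mul_avg_le_mean_sq (p n : ℕ) (hn : 1 ≤ n) (W : ℝ) (hW : 0 < W)
    (X : ℕ → ℕ → ℝ) (hX : ∀ i ∈ Finset.Icc 1 n, ∀ l ∈ Finset.Icc 1 p, W ≤ X i l)
    (w : ℕ → ℝ) (hw : ∀ l ∈ Finset.Icc 1 p, 0 ≤ w l) :
    (W * ((1 / (p : ℝ)) * ∑ l ∈ Finset.Icc 1 p, w l)) ^ 2 ≤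
      (1 / (n : ℝ)) * ∑ i ∈ Finset.Icc 1 n,
        ((1 / (p : ℝ)) * ∑ l ∈ Finset.Icc 1 p, X i l * w l) ^ 2 := by
  have hn0 : (0 : ℝ) < n := by exact_mod_cast hn
  have hs := Finset.sum_nonneg hw
  rw [one_div_mul_eq_div (n : ℝ), le_div_iff₀ hn0]
  have hcard := Finset.card_nsmul_le_sum (Finset.Icc 1 n)
    (fun i => ((1 / (p : ℝ)) * ∑ l ∈ Finset.Icc 1 p, X i l * w l) ^ 2)
    ((W * ((1 / (p : ℝ)) * ∑ l ∈ Finset.Icc 1 p, w l)) ^ 2) (by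
      intro i hi
      apply pow_le_pow_left₀ (by positivity)
      rw [mul_left_comm, Finset.mul_sum]
      gcongr with l hl
      · exact hw l hl
      · exact hX i hi l hl)
  rw [nsmul_eq_mul, Nat.card_Icc, Nat.add_sub_cancel] at hcard
  linarith

theorem sq_div_le_of_le_mul {a b S W D : ℝ} (ha : 0 ≤ a) (hS : 0 < S) (hW : 0 < W)
    (hD : (W * S) ^ 2 ≤ D) (h : a ≤ b * S) : a ^ 2 / D ≤ (b / W) ^ 2 := by
  have hD0 : 0 < D := lt_of_lt_of_le (by positivity) hD
  rw [div_le_iff₀ hD0]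
  calc a ^ 2 ≤ (b * S) ^ 2 := pow_le_pow_left₀ ha h 2
    _ = (b / W) ^ 2 * (W * S) ^ 2 := by field_simp
    _ ≤ (b / W) ^ 2 * D := by gcongr

/-- An entry `c (k - j + 1)` of a truncated linear column is at most `2 t / (1 - t) ^ 2` times the
column average, when `k ≤ p t`. -/
theorem entry_le_mul_avg {p k j t c : ℝ} (hp : 0 < p) (ht0 : 0 < t) (ht1 : t < 1)
    (hc : 0 < c) (hj : 2 ≤ j) (hjk : j ≤ k) (hkp : k ≤ p * t) :
    c * (k - j + 1) ≤
      2 * t / (1 - t) ^ 2 * ((1 / p) * (c * ((p - j + 1) * (p - j + 2) / 2))) := by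
  have h1 : 0 < 1 - t := by linarith
  have hA : p * (1 - t) ≤ p - j + 1 := by linarith
  have hB : p * (1 - t) ≤ p - j + 2 := by linarith
  have hpos : 0 < p * (1 - t) := by positivity
  calc c * (k - j + 1) ≤ c * (p * t) := by gcongr; linarith
    _ = 2 * t / (1 - t) ^ 2 * ((1 / p) * (c * ((p * (1 - t)) * (p * (1 - t)) / 2))) := by
        field_simp
    _ ≤ _ := by gcongr; linarith

/-- **The key estimate (25) in the proof of Corollary 1 of the paper.** For the explicit
inverse `M = A⁻¹` of the second finite-difference matrix (indices `1,…,p`), `t ∈ (0,1)`,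
`k = ⌊pt⌋ ≥ 1`, and predictors bounded below by `W > 0`, the quantity `α = α_{n,p}(t)`
of Theorem 1 satisfies `α ≤ (1/W)(1 + 2√p t^{3/2}/(1-t)²)`. -/
theorem alpha_bound (p n : ℕ) (hp : 3 ≤ p) (hn : 1 ≤ n)
    (W : ℝ) (hW : 0 < W) (t : ℝ) (ht : t ∈ Set.Ioo (0 : ℝ) 1)
    (k : ℕ) (hk : k = Nat.floor ((p : ℝ) * t)) (hk1 : 1 ≤ k)
    (M : ℕ → ℕ → ℝ)
    (hM : ∀ i j, M i j =
      if j = 1 then 1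
      else if j = 2 then (if i = 1 then 0 else ((i : ℝ) - 1) / p)
      else (if j ≤ i then ((i : ℝ) - (j : ℝ) + 1) / (p : ℝ) ^ 2 else 0))
    (X : ℕ → ℕ → ℝ)
    (hX : ∀ i ∈ Finset.Icc 1 n, ∀ l ∈ Finset.Icc 1 p, W ≤ X i l)
    (α : ℝ)
    (hα : α = Real.sqrt (∑ j ∈ Finset.Icc 1 k, (M k j) ^ 2 /
      ((1 / (n : ℝ)) * ∑ i ∈ Finset.Icc 1 n,
        ((1 / (p : ℝ)) * ∑ l ∈ Finset.Icc 1 p, X i l * M l j) ^ 2))) :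
    α ≤ (1 / W) * (1 + 2 * Real.sqrt p * t ^ ((3 : ℝ) / 2) / (1 - t) ^ 2) := by
  obtain ⟨ht0, ht1⟩ := ht
  have h1t : 0 < 1 - t := by linarith
  have hp0 : (0 : ℝ) < p := by exact_mod_cast (by omega : 0 < p)
  have hkp : (k : ℝ) ≤ p * t := hk ▸ Nat.floor_le (by positivity)
  have hkp' : k < p := by
    have : (k : ℝ) < p := by nlinarith
    exact_mod_cast this
  have hcol : ∀ j, 2 ≤ j → ∃ c : ℝ, 0 < c ∧
      ∀ l, 1 ≤ l → M l j = c * (if j ≤ l then (l : ℝ) - j + 1 else 0) := by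
    intro j hj
    rcases hj.eq_or_lt with rfl | hj
    · refine ⟨1 / p, by positivity, fun l hl => ?_⟩
      rw [hM, if_neg (by norm_num), if_pos rfl]
      rcases hl.eq_or_lt with rfl | hl
      · simp
      · rw [if_neg (by omega), if_pos (by omega)]
        push_cast
        ring
    · refine ⟨1 / (p : ℝ) ^ 2, by positivity, fun l _ => ?_⟩
      rw [hM, if_neg (by omega), if_neg (by omega)]
      split_ifs
      · ring
      · ring
  have hfirst : (M k 1) ^ 2 / ((1 / (n : ℝ)) * ∑ i ∈ Finset.Icc 1 n,
      ((1 / (p : ℝ)) * ∑ l ∈ Finset.Icc 1 p, X i l * M l 1) ^ 2) ≤ (1 / W) ^ 2 := by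
    have hM1 : ∀ l, M l 1 = 1 := fun l => by rw [hM, if_pos rfl]
    have havg : (1 / (p : ℝ)) * ∑ l ∈ Finset.Icc 1 p, M l 1 = 1 := by
      simp [hM1, hp0.ne']
    refine sq_div_le_of_le_mul (by simp [hM1]) (havg.symm ▸ one_pos) hW
      (sq_mul_avg_le_mean_sq p n hn W hW X hX (fun l => M l 1) (by simp [hM1])) ?_
    rw [havg, hM1, one_mul]
  have hrest : ∀ j ∈ Finset.Icc 2 k, (M k j) ^ 2 / ((1 / (n : ℝ)) * ∑ i ∈ Finset.Icc 1 n,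
      ((1 / (p : ℝ)) * ∑ l ∈ Finset.Icc 1 p, X i l * M l j) ^ 2) ≤
        (2 * t / (1 - t) ^ 2 / W) ^ 2 := by
    intro j hj
    obtain ⟨hj2, hjk⟩ := Finset.mem_Icc.mp hj
    obtain ⟨c, hc, hMc⟩ := hcol j hj2
    have hnonneg : ∀ l, 1 ≤ l → 0 ≤ M l j := by
      intro l hl
      rw [hMc l hl]
      split_ifs with h
      · have : (j : ℝ) ≤ l := by exact_mod_cast h
        exact mul_nonneg hc.le (by linarith)
      · simp
    have hsum : ∑ l ∈ Finset.Icc 1 p, M l j =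
        c * (((p : ℝ) - j + 1) * ((p : ℝ) - j + 2) / 2) := by
      rw [← sum_Icc_truncated j p (by omega) (by omega), Finset.mul_sum]
      exact Finset.sum_congr rfl fun l hl => hMc l (Finset.mem_Icc.mp hl).1
    have hjp : (j : ℝ) < p := by exact_mod_cast (by omega : j < p)
    have hpos : 0 < (1 / (p : ℝ)) * ∑ l ∈ Finset.Icc 1 p, M l j := by
      rw [hsum]
      have h1 : 0 < (p : ℝ) - j + 1 := by linarith
      have h2 : 0 < (p : ℝ) - j + 2 := by linarith
      positivity
    refine sq_div_le_of_le_mul (hnonneg k hk1) hpos hW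
      (sq_mul_avg_le_mean_sq p n hn W hW X hX (fun l => M l j)
        fun l hl => hnonneg l (Finset.mem_Icc.mp hl).1) ?_
    rw [hsum, hMc k hk1, if_pos hjk]
    exact entry_le_mul_avg hp0 ht0 ht1 hc (by exact_mod_cast hj2) (by exact_mod_cast hjk) hkp
  have htail := Finset.sum_le_card_nsmul _ _ _ hrest
  have hcard : ((Finset.Icc 2 k).card : ℝ) ≤ p * t := by
    refine le_trans ?_ hkp
    rw [Nat.card_Icc]
    exact_mod_cast (by omega : k + 1 - 2 ≤ k)
  rw [nsmul_eq_mul] at htail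
  have htail' := htail.trans (mul_le_mul_of_nonneg_right hcard (sq_nonneg _))
  have hsq : (t ^ ((3 : ℝ) / 2)) ^ 2 = t ^ 3 := by
    rw [← Real.rpow_natCast, ← Real.rpow_mul ht0.le, ← Real.rpow_natCast t 3]
    norm_num
  set y := 2 * Real.sqrt p * t ^ ((3 : ℝ) / 2) / (1 - t) ^ 2 with hy
  have hy0 : 0 ≤ y := by positivity
  have hy2 : p * t * (2 * t / (1 - t) ^ 2 / W) ^ 2 = (1 / W) ^ 2 * y ^ 2 := by
    rw [hy, div_pow (2 * _ * _), mul_pow, mul_pow, hsq, Real.sq_sqrt hp0.le]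
    field_simp
  rw [hα, ← Finset.add_sum_Ioc_eq_sum_Icc hk1]
  change √(_ + ∑ j ∈ Finset.Icc 2 k, _) ≤ _
  refine Real.sqrt_le_iff.mpr ⟨by positivity, ?_⟩
  calc _ ≤ (1 / W) ^ 2 + (1 / W) ^ 2 * y ^ 2 := add_le_add hfirst (hy2 ▸ htail')
    _ ≤ (1 / W) ^ 2 + (1 / W) ^ 2 * y ^ 2 + (1 / W) ^ 2 * (2 * y) :=
        le_add_of_nonneg_right (by positivity)
    _ = _ := by ring
end
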